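/- Let λ be a cardinal and Y an uncountable set. Then there exists a family ⟨F_𝔶 : 𝔶 ∈ Fil⁴_{ℵ₁}(Y)⟩ such that: (α) F_𝔶 is a set of functions from Z^𝔶 to λ; (β) the map f ↦ rk_{D[𝔶]}(f) is injective on F_𝔶 (so F_𝔶 is well ordered by comparing these ranks); and (γ) for every f : Y → λ there is a sequence ⟨𝔶_n : n < ω⟩ of members of Fil⁴_{ℵ₁}(Y) such that f↾Z^{𝔶_n} ∈ F_{𝔶_n} for each n and ⋃_{n<ω} Z^{𝔶_n} = Y. -/

import Mathlib

/-- `f <_D g` iff `{y | f y < g y} ∈ D`. -/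
def ltD {Y : Type} (D : Filter Y) (f g : Y → Ordinal) : Prop :=
  {y | f y < g y} ∈ D

/-- The rank `rk_D f` of `f : Y → Ord` with respect to the (well-founded, for countably
complete `D`) relation `<_D`. -/
noncomputable def rkD {Y : Type} (D : Filter Y) (f : Y → Ordinal) : Ordinal.{1} :=
  haveI := Classical.dec
  if h : Acc (ltD D) f then h.rank else 0

/-- `hrtg Y` is the least ordinal which is not a surjective image of `Y`. -/
noncomputable def hrtg (Y : Type) : Ordinal :=
  sInf {α : Ordinal | ¬ ∃ f : Y → Ordinal, Set.Iio α ⊆ Set.range f}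

/-- `Fil⁴_{ℵ₁}(Y)`: quadruples `(D₁, D₂, h, Z)` where `D₁ ⊆ D₂` are countably complete
filters on `Y`, `h : Y → α` for some ordinal `α < hrtg Y`, and `Z ∈ D₂`. -/
structure Fil4 (Y : Type) where
  D1 : Filter Y
  D2 : Filter Y
  cc1 : CountableInterFilter D1
  ne1 : D1.NeBot
  cc2 : CountableInterFilter D2
  ne2 : D2.NeBot
  sub : D1.sets ⊆ D2.sets
  bound : Ordinal
  bound_lt : bound < hrtg Y
  hfun : Y → Ordinal
  hfun_lt : ∀ y, hfun y < bound
  Z : Set Y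
  Z_mem : Z ∈ D2


namespace S11
open Filter Set

/-- `Q D γ f` says that the rank of `f` is at least `γ`. -/
def Q {Y : Type} (D : Filter Y) (γ : Ordinal.{1}) (f : Y → Ordinal.{0}) : Prop :=
  ∀ δ : Ordinal.{1}, ∀ _ : δ < γ, ∃ g, ltD D g f ∧ Q D δ g
termination_by γ

theorem Q_iff {Y : Type} (D : Filter Y) (γ : Ordinal.{1}) (f : Y → Ordinal.{0}) :
    Q D γ f ↔ ∀ δ < γ, ∃ g, ltD D g f ∧ Q D δ g := by
  rw [Q]

theorem Q_mono {Y : Type} {D D' : Filter Y} (h : D' ≤ D) (γ : Ordinal.{1}) :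
    ∀ f : Y → Ordinal.{0}, Q D γ f → Q D' γ f := by
  induction γ using WellFoundedLT.induction with
  | ind γ ih =>
    intro f hf
    rw [Q_iff] at hf ⊢
    intro δ hδ
    obtain ⟨g, hg, hq⟩ := hf δ hδ
    exact ⟨g, h hg, ih δ hδ g hq⟩

theorem Q_congr {Y : Type} {D : Filter Y} {γ : Ordinal.{1}} {f g : Y → Ordinal.{0}}
    (h : {y | f y = g y} ∈ D) (hf : Q D γ f) : Q D γ g := by
  rw [Q_iff] at hf ⊢
  intro δ hδ
  obtain ⟨k, hk, hq⟩ := hf δ hδ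
  refine ⟨k, ?_, hq⟩
  unfold ltD at *
  filter_upwards [h, hk] with y h1 h2
  rwa [← h1]

theorem Q_bot {Y : Type} (γ : Ordinal.{1}) (f : Y → Ordinal.{0}) : Q (⊥ : Filter Y) γ f := by
  induction γ using WellFoundedLT.induction generalizing f with
  | ind γ ih =>
    rw [Q_iff]
    exact fun δ hδ => ⟨f, by simp [ltD], ih δ hδ f⟩

theorem Q_union {Y : Type} {D : Filter Y} [CountableInterFilter D] (γ : Ordinal.{1}) :
    ∀ (f : Y → Ordinal.{0}) (Z : ℕ → Set Y), (⋃ n, Z n) ∈ D →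
      (∀ n, Q (D ⊓ 𝓟 (Z n)) γ f) → Q D γ f := by
  induction γ using WellFoundedLT.induction with
  | ind γ ih =>
    intro f Z hZ hf
    rw [Q_iff]
    intro δ hδ
    have h1 : ∀ n, ∃ g, ltD (D ⊓ 𝓟 (Z n)) g f ∧ Q (D ⊓ 𝓟 (Z n)) δ g :=
      fun n => (Q_iff _ _ _).1 (hf n) δ hδ
    choose g hg hq using h1
    classical
    let idx : Y → ℕ := fun y => if h : ∃ n, y ∈ Z n then Nat.find h else 0
    have hidx : ∀ y, y ∈ (⋃ n, Z n) → y ∈ Z (idx y) := by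
      intro y hy
      have h : ∃ n, y ∈ Z n := by simpa using hy
      simp only [idx, dif_pos h]
      exact Nat.find_spec h
    refine ⟨fun y => g (idx y) y, ?_, ?_⟩
    · have h2 : ∀ n, {y | y ∈ Z n → g n y < f y} ∈ D := fun n => by
        have := hg n
        unfold ltD at this
        rw [mem_inf_principal] at this
        exact this
      have h3 := (countable_iInter_mem (l := D)).2 h2
      unfold ltD
      filter_upwards [h3, hZ] with y hy1 hy2
      exact mem_iInter.1 hy1 (idx y) (hidx y hy2)
    · refine ih δ hδ _ (fun n => Z n ∩ {y | idx y = n}) ?_ ?_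
      · filter_upwards [hZ] with y hy
        exact mem_iUnion.2 ⟨idx y, hidx y hy, rfl⟩
      · intro n
        have h4 : Q (D ⊓ 𝓟 (Z n ∩ {y | idx y = n})) δ (g n) :=
          Q_mono (inf_le_inf_left _ (principal_mono.2 inter_subset_left)) _ _ (hq n)
        refine Q_congr ?_ h4
        rw [mem_inf_principal]
        refine univ_mem' fun y hy => ?_
        have : idx y = n := hy.2
        simp [this]

theorem Q_union2 {Y : Type} {D : Filter Y} [CountableInterFilter D] {γ : Ordinal.{1}}
    {f : Y → Ordinal.{0}} {Z : Set Y}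
    (h1 : Q (D ⊓ 𝓟 Z) γ f) (h2 : Q (D ⊓ 𝓟 Zᶜ) γ f) : Q D γ f := by
  refine Q_union γ f (fun n => if n = 0 then Z else Zᶜ) ?_ ?_
  · refine univ_mem' fun y => ?_
    by_cases hy : y ∈ Z
    · exact mem_iUnion.2 ⟨0, by simpa using hy⟩
    · exact mem_iUnion.2 ⟨1, by simpa using hy⟩
  · intro n
    by_cases hn : n = 0
    · simpa [hn] using h1
    · simpa [hn] using h2

theorem ltD_wf {Y : Type} (D : Filter Y) [CountableInterFilter D] [D.NeBot] :
    WellFounded (ltD.{0} D) := by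
  rw [wellFounded_iff_isEmpty_descending_chain]
  refine ⟨fun ⟨u, hu⟩ => ?_⟩
  have h3 := (countable_iInter_mem (l := D)).2 hu
  obtain ⟨y, hy⟩ := Filter.nonempty_of_mem h3
  have hy' : ∀ n, u (n + 1) y < u n y := fun n => mem_iInter.1 hy n
  have := (wellFounded_iff_isEmpty_descending_chain (r := ((· < ·) : Ordinal.{0} → _ → Prop))).1
    wellFounded_lt
  exact this.false ⟨fun n => u n y, hy'⟩

theorem Q_iff_le {Y : Type} (D : Filter Y) [CountableInterFilter D] [D.NeBot]
    (γ : Ordinal.{1}) (f : Y → Ordinal.{0}) : Q D γ f ↔ γ ≤ rkD D f := by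
  have hacc : ∀ f, Acc (ltD D) f := fun f => (ltD_wf D).apply f
  have hrk : ∀ f, rkD D f = (hacc f).rank := fun f => by
    unfold rkD
    rw [dif_pos (hacc f)]
  induction γ using WellFoundedLT.induction generalizing f with
  | ind γ ih =>
    rw [Q_iff]
    constructor
    · intro h
      refine le_of_forall_lt fun δ hδ => ?_
      obtain ⟨g, hg, hq⟩ := h δ hδ
      refine ((ih δ hδ g).1 hq).trans_lt ?_
      rw [hrk, hrk]
      exact Acc.rank_lt_of_rel (hacc f) hg
    · intro h δ hδ
      have h1 : δ < (hacc f).rank := by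
        rw [← hrk]; exact hδ.trans_le h
      rw [Acc.rank_eq, Ordinal.lt_iSup_iff] at h1
      obtain ⟨⟨g, hg⟩, h2⟩ := h1
      refine ⟨g, hg, (ih δ hδ g).2 ?_⟩
      rw [hrk]
      exact Order.lt_succ_iff.1 h2

/-- the dual filter of the ideal `J[f, D]`. -/
def Dtwo {Y : Type} (D : Filter Y) [CountableInterFilter D] (f : Y → Ordinal.{0})
    (γ : Ordinal.{1}) : Filter Y where
  sets := {Z | Q (D ⊓ 𝓟 Zᶜ) γ f}
  univ_sets := by simpa using Q_bot γ f
  sets_of_superset := by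
    intro x y hx hxy
    exact Q_mono (inf_le_inf_left _ (principal_mono.2 (compl_subset_compl.2 hxy))) _ _ hx
  inter_sets := by
    intro x y hx hy
    refine Q_union2 (Z := x) ?_ ?_
    · refine Q_mono ?_ _ _ hy
      rw [inf_assoc, inf_principal]
      refine inf_le_inf_left _ (principal_mono.2 ?_)
      rintro z ⟨h1, h2⟩ h3
      exact h1 ⟨h2, h3⟩
    · exact Q_mono (inf_le_inf_right _ inf_le_left) _ _ hx

theorem mem_Dtwo {Y : Type} {D : Filter Y} [CountableInterFilter D] {f : Y → Ordinal.{0}}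
    {γ : Ordinal.{1}} {Z : Set Y} : Z ∈ Dtwo D f γ ↔ Q (D ⊓ 𝓟 Zᶜ) γ f := Iff.rfl

theorem Dtwo_cc {Y : Type} (D : Filter Y) [CountableInterFilter D] (f : Y → Ordinal.{0})
    (γ : Ordinal.{1}) : CountableInterFilter (Dtwo D f γ) := by
  refine ⟨fun S hS h => ?_⟩
  rcases S.eq_empty_or_nonempty with rfl | hne
  · simp
  obtain ⟨u, rfl⟩ := hS.exists_eq_range hne
  rw [mem_Dtwo]
  refine Q_union γ f (fun n => (u n)ᶜ) ?_ ?_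
  · rw [mem_inf_principal]
    refine univ_mem' fun y hy => ?_
    simpa using hy
  · intro n
    exact Q_mono (inf_le_inf_right _ inf_le_left) _ _ (h (u n) ⟨n, rfl⟩)

theorem le_Dtwo {Y : Type} (D : Filter Y) [CountableInterFilter D] (f : Y → Ordinal.{0})
    (γ : Ordinal.{1}) : D.sets ⊆ (Dtwo D f γ).sets := by
  intro Z hZ
  change Q (D ⊓ 𝓟 Zᶜ) γ f
  have : D ⊓ 𝓟 Zᶜ = ⊥ := by
    rw [← empty_mem_iff_bot, mem_inf_principal]
    filter_upwards [hZ] with y hy h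
    exact h hy
  rw [this]
  exact Q_bot _ _

theorem Dtwo_ne {Y : Type} (D : Filter Y) [CountableInterFilter D] [D.NeBot]
    (f : Y → Ordinal.{0}) : (Dtwo D f (Order.succ (rkD D f))).NeBot := by
  refine ⟨fun h => ?_⟩
  rw [← empty_mem_iff_bot, mem_Dtwo] at h
  simp only [compl_empty, principal_univ, inf_top_eq] at h
  rw [Q_iff_le] at h
  exact absurd h (not_le.2 (Order.lt_succ _))

/-- the requirement on representatives. -/
def P {Y : Type} (lam : Cardinal.{0}) (D1 D2 : Filter Y) [CountableInterFilter D1]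
    (α : Ordinal.{1}) (f : Y → Ordinal.{0}) : Prop :=
  (∀ y, f y < lam.ord) ∧ rkD D1 f = α ∧ D2 = Dtwo D1 f (Order.succ α)

/-- two functions with the same data: `{f < g}` is null. -/
theorem lt_null {Y : Type} {lam : Cardinal.{0}} {D1 D2 : Filter Y} [CountableInterFilter D1]
    [D1.NeBot] {α : Ordinal.{1}} {f g : Y → Ordinal.{0}} (hf : P lam D1 D2 α f)
    (hg : P lam D1 D2 α g) : {y | f y < g y}ᶜ ∈ D2 := by
  rw [hg.2.2, mem_Dtwo, compl_compl, Q_iff]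
  intro δ hδ
  refine ⟨f, ?_, ?_⟩
  · exact mem_inf_of_right (mem_principal_self _)
  · refine Q_mono inf_le_left _ _ ?_
    rw [Q_iff_le, hf.2.1]
    exact Order.lt_succ_iff.1 hδ

theorem eq_mem {Y : Type} {lam : Cardinal.{0}} {D1 D2 : Filter Y} [CountableInterFilter D1]
    [D1.NeBot] {α : Ordinal.{1}} {f g : Y → Ordinal.{0}} (hf : P lam D1 D2 α f)
    (hg : P lam D1 D2 α g) : {y | f y = g y} ∈ D2 := by
  filter_upwards [lt_null hf hg, lt_null hg hf] with y h1 h2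
  exact le_antisymm (not_lt.1 h2) (not_lt.1 h1)

theorem rk_restrict {Y : Type} {lam : Cardinal.{0}} {D1 D2 : Filter Y} [CountableInterFilter D1]
    [D1.NeBot] [D2.NeBot] (hsub : D1.sets ⊆ D2.sets) {α : Ordinal.{1}} {f : Y → Ordinal.{0}}
    (hf : P lam D1 D2 α f) {Z : Set Y} (hZ : Z ∈ D2) :
    rkD (D1 ⊓ 𝓟 Z) (Z.indicator f) = α := by
  have hne : (D1 ⊓ 𝓟 Z).NeBot := by
    refine NeBot.mono ‹D2.NeBot› (le_inf (fun s hs => hsub hs) ?_)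
    rwa [le_principal_iff]
  have hZc : {y | Z.indicator f y = f y} ∈ D1 ⊓ 𝓟 Z := by
    rw [mem_inf_principal]
    exact univ_mem' fun y hy => indicator_of_mem hy f
  refine le_antisymm ?_ ?_
  · by_contra hlt
    rw [not_le, ← Order.succ_le_iff, ← Q_iff_le] at hlt
    have h1 := Q_congr hZc hlt
    rw [hf.2.2, mem_Dtwo] at hZ
    have h2 := Q_union2 h1 hZ
    rw [Q_iff_le, hf.2.1] at h2
    exact absurd h2 (not_le.2 (Order.lt_succ _))
  · rw [← Q_iff_le]
    refine Q_congr (f := f) ?_ (Q_mono inf_le_left _ _ ((Q_iff_le _ _ _).2 hf.2.1.ge))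
    filter_upwards [hZc] with y hy
    exact hy.symm

theorem one_lt_hrtg (Y : Type) [Nontrivial Y] : (1 : Ordinal) < hrtg Y := by
  unfold hrtg
  have hne : {α : Ordinal | ¬ ∃ f : Y → Ordinal, Set.Iio α ⊆ Set.range f}.Nonempty := by
    by_contra hemp
    rw [not_nonempty_iff_eq_empty, eq_empty_iff_forall_notMem] at hemp
    have h := hemp (Order.succ (Cardinal.lift (Cardinal.mk Y))).ord
    rw [mem_setOf_eq, not_not] at h
    obtain ⟨f, hf⟩ := h
    have h1 := Cardinal.mk_le_mk_of_subset hf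
    have h2 := Cardinal.mk_range_le_lift (f := f)
    have h3 := (Cardinal.lift_le.{0}.2 h1).trans h2
    rw [Cardinal.mk_Iio_ordinal, Cardinal.card_ord] at h3
    simp only [Cardinal.lift_succ, Cardinal.lift_lift, Cardinal.lift_uzero, Order.succ_le_iff] at h3
    exact lt_irrefl _ h3
  have hmem := csInf_mem hne
  by_contra hle
  rw [not_lt] at hle
  refine hmem ⟨fun _ => 0, fun x hx => ?_⟩
  obtain ⟨y, -⟩ := exists_pair_ne Y
  refine ⟨y, ?_⟩
  have : x < 1 := lt_of_lt_of_le hx hle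
  exact (Ordinal.lt_one_iff_zero.1 this).symm

open Classical in
/-- chosen representative -/
noncomputable def rep {Y : Type} (lam : Cardinal.{0}) (D1 D2 : Filter Y) [CountableInterFilter D1]
    (α : Ordinal.{1}) : Y → Ordinal.{0} :=
  if h : ∃ f, P lam D1 D2 α f then h.choose else 0

theorem rep_spec {Y : Type} {lam : Cardinal.{0}} {D1 D2 : Filter Y} [CountableInterFilter D1]
    {α : Ordinal.{1}} {f : Y → Ordinal.{0}} (hf : P lam D1 D2 α f) :
    P lam D1 D2 α (rep lam D1 D2 α) := by
  have h : ∃ f, P lam D1 D2 α f := ⟨f, hf⟩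
  unfold rep
  rw [dif_pos h]
  exact h.choose_spec

/-- the family -/
def Fam {Y : Type} (lam : Cardinal.{0}) (x : Fil4 Y) : Set (Y → Ordinal.{0}) :=
  haveI := x.cc1
  {u | ∃ α, P lam x.D1 x.D2 α (rep lam x.D1 x.D2 α) ∧ u = x.Z.indicator (rep lam x.D1 x.D2 α)}

end S11

open Filter Set S11

/-- for a cardinal `λ` and an uncountable set `Y` there is a family
`⟨F_𝔶 : 𝔶 ∈ Fil⁴_{ℵ₁}(Y)⟩` such that: (α) `F_𝔶` is a set of functions from `Z^𝔶` to `λ`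
(coded as functions on `Y` vanishing off `Z^𝔶`); (β) `f ↦ rk_{D[𝔶]} f` is injective on
`F_𝔶` (where `D[𝔶]` is the filter generated by `D₁ ∪ {Z^𝔶}`); (γ) every `f : Y → λ`
admits `⟨𝔶_n : n < ω⟩` with `f↾Z^{𝔶_n} ∈ F_{𝔶_n}` for all `n` and `⋃_n Z^{𝔶_n} = Y`. -/
theorem stmt11 (lam : Cardinal) (Y : Type) (hY : Uncountable Y) :
    ∃ F : Fil4 Y → Set (Y → Ordinal),
      (∀ 𝔶 : Fil4 Y, ∀ f ∈ F 𝔶, (∀ y ∈ 𝔶.Z, f y < lam.ord) ∧ ∀ y ∉ 𝔶.Z, f y = 0) ∧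
      (∀ 𝔶 : Fil4 Y, ∀ f ∈ F 𝔶, ∀ g ∈ F 𝔶,
        rkD (𝔶.D1 ⊓ Filter.principal 𝔶.Z) f = rkD (𝔶.D1 ⊓ Filter.principal 𝔶.Z) g →
          f = g) ∧
      (∀ f : Y → Ordinal, (∀ y, f y < lam.ord) →
        ∃ yseq : ℕ → Fil4 Y,
          (∀ n, (yseq n).Z.indicator f ∈ F (yseq n)) ∧
          ⋃ n, (yseq n).Z = Set.univ) := by
  refine ⟨Fam lam, ?_, ?_, ?_⟩
  · rintro x f ⟨α, hP, rfl⟩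
    refine ⟨fun y hy => ?_, fun y hy => indicator_of_notMem hy _⟩
    rw [indicator_of_mem hy]
    exact hP.1 y
  · rintro x f ⟨α, hP, rfl⟩ g ⟨β, hP', rfl⟩ h
    have := x.cc1
    have := x.ne1
    have := x.ne2
    rw [rk_restrict x.sub hP x.Z_mem, rk_restrict x.sub hP' x.Z_mem] at h
    rw [h]
  · intro f hf
    by_contra hcon
    let G : Set (Set Y) := {A | ∃ x : Fil4 Y, x.Z = Aᶜ ∧ x.Z.indicator f ∈ Fam lam x}
    let D : Filter Y := countableGenerate G
    have : CountableInterFilter D := inferInstanceAs (CountableInterFilter (countableGenerate G))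
    have hne : D.NeBot := by
      refine ⟨fun h => hcon ?_⟩
      rw [← empty_mem_iff_bot] at h
      obtain ⟨S, hSG, hSc, hS⟩ := mem_countableGenerate_iff.1 h
      have hSn : S.Nonempty := by
        by_contra hemp
        rw [not_nonempty_iff_eq_empty] at hemp
        subst hemp
        obtain ⟨y⟩ : Nonempty Y := inferInstance
        have : y ∈ (∅ : Set Y) := hS (by simp)
        exact this
      obtain ⟨u, rfl⟩ := hSc.exists_eq_range hSn
      have hu : ∀ n, u n ∈ G := fun n => hSG ⟨n, rfl⟩
      choose x hx1 hx2 using hu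
      refine ⟨x, hx2, ?_⟩
      rw [eq_univ_iff_forall]
      intro y
      by_contra hy
      have : y ∈ (∅ : Set Y) := by
        refine hS ?_
        rintro _ ⟨n, rfl⟩
        by_contra hyn
        exact hy (mem_iUnion.2 ⟨n, by rw [hx1 n]; exact hyn⟩)
      exact this
    let α := rkD D f
    let D2 := Dtwo D f (Order.succ α)
    have hPf : P lam D D2 α f := ⟨hf, rfl, rfl⟩
    have hPr := rep_spec hPf
    have h2ne : D2.NeBot := Dtwo_ne D f
    have hZ : {y | f y = rep lam D D2 α y} ∈ D2 := eq_mem hPf hPr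
    have hsub : D.sets ⊆ D2.sets := le_Dtwo D f _
    let x : Fil4 Y :=
      { D1 := D
        D2 := D2
        cc1 := inferInstance
        ne1 := hne
        cc2 := Dtwo_cc D f _
        ne2 := h2ne
        sub := hsub
        bound := 1
        bound_lt := one_lt_hrtg Y
        hfun := fun _ => 0
        hfun_lt := fun _ => zero_lt_one
        Z := {y | f y = rep lam D D2 α y}
        Z_mem := hZ }
    have hG : {y | f y = rep lam D D2 α y}ᶜ ∈ G := by
      refine ⟨x, (compl_compl _).symm, α, hPr, ?_⟩
      ext y
      by_cases hy : y ∈ x.Z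
      · rw [indicator_of_mem hy, indicator_of_mem hy]
        exact hy
      · rw [indicator_of_notMem hy, indicator_of_notMem hy]
    have hD : {y | f y = rep lam D D2 α y}ᶜ ∈ D := CountableGenerateSets.basic hG
    have hb := inter_mem (hsub hD) hZ
    rw [compl_inter_self] at hb
    exact h2ne.ne (empty_mem_iff_bot.1 hb)
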